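/- arXiv:hep-th/9407115 — 2 statements merged into one kernel-verified Lean document; each statement's English description precedes it below -/
import Mathlib

section
/- Let n ≥ 2, let a_1, …, a_n be nonzero real numbers and b_1, …, b_n real numbers such that the ratios b_j/a_j are pairwise distinct, and define linear forms λ^j(z_1, z_2) = a_j z_1 + b_j z_2 on ℂ². Let Y_1, Y_2 be real numbers with Y_2 ≠ 0 and Y_1 ≠ −(b_j/a_j) Y_2 for all j, let p(z_1, z_2) be a homogeneous complex polynomial of total degree n − 2, and set Q_j = (−b_j/a_j, 1) ∈ ℝ². Then for every real x_2 the function x_1 ↦ p(x_1 + iY_1, x_2 + iY_2) / ∏_{j=1}^n λ^j(x_1 + iY_1, x_2 + iY_2) is integrable on ℝ, and the iterated integral lim_{R→∞} ∫_{−R}^{R} [ ∫_ℝ e^{i(x_2+iY_2)} p(x_1+iY_1, x_2+iY_2) / ∏_{j=1}^n λ^j(x_1+iY_1, x_2+iY_2) dx_1 ] dx_2 equals (2πi)² Σ_{j ∈ S} p(Q_j) / ( a_j ∏_{l ≠ j} (b_l − a_l b_j/a_j) ) if Y_2 < 0, where S = { j : −(b_j/a_j) Y_2 > Y_1 }, and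 equals 0 if Y_2 > 0. -/
open MeasureTheory Filter Finset intervalIntegral

lemma jk_den_ne (w : ℂ) (hw : w.im ≠ 0) (x : ℝ) : (x : ℂ) - w ≠ 0 := by
  intro h
  apply hw
  have := congrArg Complex.im h
  simpa using this

lemma jk_sq_ne (x : ℝ) : (1 : ℂ) + (x : ℂ) ^ 2 ≠ 0 := by
  have h : (1 + x ^ 2 : ℝ) ≠ 0 := by positivity
  exact_mod_cast h

lemma jk_integrable (w : ℂ) (hw : w.im ≠ 0) :
    Integrable (fun x : ℝ => ((x : ℂ) - w)⁻¹ - (x : ℂ) / (1 + (x : ℂ) ^ 2)) := by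
  have hC := (integrable_inv_one_add_sq).const_mul (‖w‖ + ‖1 + w ^ 2‖ / |w.im|)
  refine hC.mono' ?_ ?_
  · apply Continuous.aestronglyMeasurable
    have h1 := jk_den_ne w hw
    have h2 := jk_sq_ne
    fun_prop (disch := assumption)
  · refine Eventually.of_forall fun x => ?_
    have h1 := jk_den_ne w hw x
    have h2 := jk_sq_ne x
    have e : ((x : ℂ) - w)⁻¹ - (x : ℂ) / (1 + (x : ℂ) ^ 2)
        = (w + (1 + w ^ 2) / ((x : ℂ) - w)) * (((1 + x ^ 2)⁻¹ : ℝ) : ℂ) := by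
      push_cast
      field_simp
      ring
    rw [e, norm_mul]
    have h3 : ‖(((1 + x ^ 2)⁻¹ : ℝ) : ℂ)‖ = (1 + x ^ 2)⁻¹ := by
      rw [Complex.norm_real, Real.norm_of_nonneg (by positivity)]
    rw [h3]
    gcongr
    refine (norm_add_le _ _).trans ?_
    gcongr
    rw [norm_div]
    have h4 : |w.im| ≤ ‖(x : ℂ) - w‖ := by
      have := Complex.abs_im_le_norm ((x : ℂ) - w)
      simpa using this
    have : 0 < |w.im| := abs_pos.mpr hw
    gcongr

lemma jk_log_diff (s : ℝ) (hs : s = 1 ∨ s = -1) :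
    Complex.log (Complex.I * s) - Complex.log (-(Complex.I * s)) = s * Real.pi * Complex.I := by
  rcases hs with rfl | rfl
  · simp only [Complex.ofReal_one, mul_one, Complex.log_I, Complex.log_neg_I]; ring
  · simp only [Complex.ofReal_neg, Complex.ofReal_one, mul_neg, mul_one, neg_neg, Complex.log_I,
      Complex.log_neg_I]; ring

lemma jk_tendsto_aux (w : ℂ) (hw : w.im ≠ 0) (c e : ℂ) (he : c * e ∈ Complex.slitPlane)
    (he2 : e ^ 2 = 1) (hc : c ≠ 0) (l : Filter ℝ)
    (hl : Tendsto (fun x : ℝ => ((x : ℂ))⁻¹) l (nhds 0))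
    (hl2 : ∀ᶠ x : ℝ in l, x ≠ 0 ∧ ((|x| : ℝ) : ℂ) = e * x) :
    Tendsto (fun x : ℝ => Complex.log (c * ((x : ℂ) - w)) -
      ((1 / 2 * Real.log (1 + x ^ 2) : ℝ) : ℂ)) l (nhds (Complex.log (c * e))) := by
  have h1 : Tendsto (fun x : ℝ => Complex.log (c * e * (1 - w * (x : ℂ)⁻¹)) -
      1 / 2 * Complex.log (1 + ((x : ℂ)⁻¹) ^ 2)) l
      (nhds (Complex.log (c * e * (1 - w * 0)) - 1 / 2 * Complex.log (1 + 0 ^ 2))) := by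
    refine Tendsto.sub ?_ ?_
    · refine Tendsto.clog ?_ (by simpa using he)
      exact ((hl.const_mul w).const_sub 1).const_mul _
    · refine Tendsto.const_mul _ (Tendsto.clog ((hl.pow 2).const_add 1) (by simp))
  have h2 : Complex.log (c * e * (1 - w * 0)) - 1 / 2 * Complex.log (1 + 0 ^ 2)
      = Complex.log (c * e) := by simp
  rw [h2] at h1
  refine h1.congr' ?_
  filter_upwards [hl2] with x hx
  obtain ⟨hx, hxe⟩ := hx
  have hxc : (x : ℂ) ≠ 0 := by exact_mod_cast hx
  have hpos : 0 < |x| := abs_pos.mpr hx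
  have e1 : c * ((x : ℂ) - w) = ((|x| : ℝ) : ℂ) * (c * e * (1 - w * (x : ℂ)⁻¹)) := by
    rw [hxe]
    field_simp
    linear_combination (-(↑x - w)) * he2
  have hne : c * e * (1 - w * (x : ℂ)⁻¹) ≠ 0 := by
    intro h
    rw [h, mul_zero] at e1
    exact (mul_ne_zero hc (jk_den_ne w hw x)) e1
  have e2 : Complex.log (1 + ((x : ℂ)⁻¹) ^ 2) = ((Real.log (1 + (x⁻¹) ^ 2) : ℝ) : ℂ) := by
    rw [Complex.ofReal_log (by positivity)]
    push_cast; rfl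
  have e3 : Real.log (1 + x ^ 2) = 2 * Real.log |x| + Real.log (1 + (x⁻¹) ^ 2) := by
    have : 1 + x ^ 2 = |x| ^ 2 * (1 + (x⁻¹) ^ 2) := by
      rw [sq_abs]; field_simp; ring
    rw [this, Real.log_mul (by positivity) (by positivity), Real.log_pow]
    norm_num
  rw [e1, Complex.log_ofReal_mul hpos hne, e2, e3]
  push_cast
  ring

lemma jk_integral (w : ℂ) (s : ℝ) (hs : s = 1 ∨ s = -1) (hw : 0 < s * w.im) :
    ∫ x : ℝ, (((x : ℂ) - w)⁻¹ - (x : ℂ) / (1 + (x : ℂ) ^ 2)) = s * Real.pi * Complex.I := by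
  have hw' : w.im ≠ 0 := by rintro h; simp [h] at hw
  have hs0 : s ≠ 0 := by rintro h; simp [h] at hw
  have hc : Complex.I * (s : ℂ) ≠ 0 := mul_ne_zero Complex.I_ne_zero (by exact_mod_cast hs0)
  have hinv : Tendsto (fun x : ℝ => ((x : ℂ))⁻¹) atTop (nhds 0) := by
    have := (Complex.continuous_ofReal.tendsto 0).comp tendsto_inv_atTop_zero
    refine (this.congr fun x => ?_).trans (by simp)
    simp
  have hinv' : Tendsto (fun x : ℝ => ((x : ℂ))⁻¹) atBot (nhds 0) := by
    have := (Complex.continuous_ofReal.tendsto 0).comp tendsto_inv_atBot_zero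
    refine (this.congr fun x => ?_).trans (by simp)
    simp
  rw [← jk_log_diff s hs]
  have hslit : ∀ e : ℂ, e = 1 ∨ e = -1 → Complex.I * s * e ∈ Complex.slitPlane := by
    rintro e (rfl | rfl) <;> (right; simpa using hs0)
  refine integral_of_hasDerivAt_of_tendsto (f := fun x : ℝ =>
    Complex.log (Complex.I * s * ((x : ℂ) - w)) - ((1 / 2 * Real.log (1 + x ^ 2) : ℝ) : ℂ))
    ?_ (jk_integrable w hw') ?_ ?_
  · intro x
    have h1 := jk_den_ne w hw' x
    have d1 : HasDerivAt (fun x : ℝ => Complex.I * s * ((x : ℂ) - w)) (Complex.I * s * 1) x :=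
      ((Complex.ofRealCLM.hasDerivAt (x := x)).sub_const w).const_mul _
    have d2 := d1.clog_real (by left; simpa using hw)
    have d3 : HasDerivAt (fun x : ℝ => 1 / 2 * Real.log (1 + x ^ 2))
        (1 / 2 * ((2 * x) / (1 + x ^ 2))) x := by
      have : HasDerivAt (fun x : ℝ => 1 + x ^ 2) (2 * x) x := by
        simpa using (hasDerivAt_pow 2 x).const_add 1
      exact (this.log (by positivity)).const_mul _
    have d4 := d2.sub d3.ofReal_comp
    refine d4.congr_deriv ?_
    have h2 := jk_sq_ne x
    have h3 : (s : ℂ) ≠ 0 := by exact_mod_cast hs0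
    push_cast
    field_simp
  · have := jk_tendsto_aux w hw' (Complex.I * s) (-1) (hslit _ (Or.inr rfl)) (by norm_num) hc
      atBot hinv' (by
        filter_upwards [eventually_lt_atBot 0] with x hx
        refine ⟨hx.ne, ?_⟩
        rw [abs_of_neg hx]; push_cast; ring)
    simpa using this
  · have := jk_tendsto_aux w hw' (Complex.I * s) 1 (hslit _ (Or.inl rfl)) (by norm_num) hc
      atTop hinv (by
        filter_upwards [eventually_gt_atTop 0] with x hx
        refine ⟨hx.ne', ?_⟩
        rw [abs_of_pos hx]; push_cast; ring)
    simpa using this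

/-- symmetric improper integral of `1/(x-w)` -/
lemma jk_symm (w : ℂ) (s : ℝ) (hs : s = 1 ∨ s = -1) (hw : 0 < s * w.im) :
    Tendsto (fun R : ℝ => ∫ x in (-R)..R, ((x : ℂ) - w)⁻¹) atTop
      (nhds (s * Real.pi * Complex.I)) := by
  have hw' : w.im ≠ 0 := by rintro h; simp [h] at hw
  rw [← jk_integral w s hs hw]
  have := intervalIntegral_tendsto_integral (jk_integrable w hw') tendsto_neg_atTop_atBot tendsto_id
  refine this.congr fun R => ?_
  have h1 := jk_den_ne w hw'
  have h2 := jk_sq_ne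
  rw [intervalIntegral.integral_sub]
  · have : ∫ x in (-R)..R, (x : ℂ) / (1 + (x : ℂ) ^ 2) = 0 := by
      have h := intervalIntegral.integral_comp_neg (a := -R) (b := R)
        (fun x : ℝ => (x : ℂ) / (1 + (x : ℂ) ^ 2))
      simp only [Complex.ofReal_neg, neg_neg, even_two, Even.neg_pow, neg_div,
        intervalIntegral.integral_neg] at h
      have h' := self_eq_neg.mp h.symm
      exact h'
    simp only [id] at *
    rw [this, sub_zero]
  · apply Continuous.intervalIntegrable
    fun_prop (disch := assumption)
  · apply Continuous.intervalIntegrable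
    fun_prop (disch := assumption)

lemma jk_norm_ge_re (R y : ℝ) : |R| ≤ ‖(R : ℂ) + y * Complex.I‖ := by
  have := Complex.abs_re_le_norm ((R : ℂ) + y * Complex.I)
  simpa using this

lemma jk_norm_ge_im (R y : ℝ) : |y| ≤ ‖(R : ℂ) + y * Complex.I‖ := by
  have := Complex.abs_im_le_norm ((R : ℂ) + y * Complex.I)
  simpa using this

lemma jk_norm_exp (R y : ℝ) :
    ‖Complex.exp (Complex.I * ((R : ℂ) + y * Complex.I))‖ = Real.exp (-y) := by
  rw [Complex.norm_exp]
  simp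

/-- side bound -/
lemma jk_side (Y T R : ℝ) (r : ℝ) (hr : |r| = R) (hR : 0 < R) (hYT : Y ≤ T) :
    ‖∫ y in Y..T, Complex.exp (Complex.I * ((r : ℂ) + y * Complex.I)) /
      ((r : ℂ) + y * Complex.I)‖ ≤ Real.exp (-Y) / R := by
  have h1 : ‖∫ y in Y..T, Complex.exp (Complex.I * ((r : ℂ) + y * Complex.I)) /
      ((r : ℂ) + y * Complex.I)‖ ≤ ∫ y in Y..T, Real.exp (-y) / R := by
    refine intervalIntegral.norm_integral_le_of_norm_le hYT ?_ ?_
    · refine Eventually.of_forall fun y _ => ?_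
      rw [norm_div, jk_norm_exp]
      have := jk_norm_ge_re r y
      rw [hr] at this
      gcongr
    · apply Continuous.intervalIntegrable
      fun_prop
  refine h1.trans ?_
  rw [intervalIntegral.integral_div, intervalIntegral.integral_comp_neg (fun y => Real.exp y),
    integral_exp]
  gcongr
  have := Real.exp_pos (-T)
  linarith

lemma jk_rect (f : ℂ → ℂ) (R Y T : ℝ)
    (H : DifferentiableOn ℂ f (Set.uIcc (-R) R ×ℂ Set.uIcc Y T)) :
    ∫ x in (-R)..R, f (x + Y * Complex.I) = (∫ x in (-R)..R, f (x + T * Complex.I))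
      - Complex.I * (∫ y in Y..T, f ((R : ℝ) + y * Complex.I))
      + Complex.I * (∫ y in Y..T, f (((-R : ℝ) : ℂ) + y * Complex.I)) := by
  have := Complex.integral_boundary_rect_eq_zero_of_differentiableOn f ⟨-R, Y⟩ ⟨R, T⟩ H
  simp only [smul_eq_mul] at this
  linear_combination this

lemma jk_pos (Y : ℝ) (hY : 0 < Y) :
    Tendsto (fun R : ℝ => ∫ x in (-R)..R, Complex.exp (Complex.I * ((x : ℂ) + Y * Complex.I)) /
      ((x : ℂ) + Y * Complex.I)) atTop (nhds 0) := by
  have hb : Tendsto (fun R : ℝ => 2 * Real.exp (-R) + Real.exp (-Y) / R + Real.exp (-Y) / R) atTop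
      (nhds 0) := by
    have h1 : Tendsto (fun R : ℝ => 2 * Real.exp (-R)) atTop (nhds (2 * 0)) :=
      (Real.tendsto_exp_neg_atTop_nhds_zero).const_mul 2
    have h2 : Tendsto (fun R : ℝ => Real.exp (-Y) / R) atTop (nhds 0) :=
      tendsto_const_nhds.div_atTop tendsto_id
    simpa using (h1.add h2).add h2
  refine squeeze_zero_norm' ?_ hb
  filter_upwards [eventually_ge_atTop Y] with R hR
  have hR0 : 0 < R := hY.trans_le hR
  have hd : DifferentiableOn ℂ (fun z : ℂ => Complex.exp (Complex.I * z) / z)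
      (Set.uIcc (-R) R ×ℂ Set.uIcc Y R) := by
    intro z hz
    have hz0 : z ≠ 0 := by
      rintro rfl
      have := hz.2
      rw [Set.uIcc_of_le hR] at this
      have h := this.1
      simp at h
      linarith
    apply DifferentiableAt.differentiableWithinAt
    fun_prop (disch := assumption)
  rw [jk_rect _ R Y R hd]
  refine (norm_add_le _ _).trans (add_le_add ((norm_sub_le _ _).trans (add_le_add ?_ ?_)) ?_)
  · have := intervalIntegral.norm_integral_le_of_norm_le_const (a := -R) (b := R)
      (C := Real.exp (-R) / R) (f := fun x : ℝ =>
        Complex.exp (Complex.I * ((x : ℂ) + R * Complex.I)) / ((x : ℂ) + R * Complex.I)) (by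
        intro x _
        rw [norm_div, jk_norm_exp]
        have := jk_norm_ge_im x R
        rw [abs_of_pos hR0] at this
        gcongr)
    refine this.trans (le_of_eq ?_)
    rw [abs_of_pos (by linarith)]
    field_simp
    ring
  · rw [norm_mul, Complex.norm_I, one_mul]
    exact jk_side Y R R R (abs_of_pos hR0) hR0 hR
  · rw [norm_mul, Complex.norm_I, one_mul]
    exact jk_side Y R R (-R) (by rw [abs_neg, abs_of_pos hR0]) hR0 hR

lemma jk_line_ne (Y : ℝ) (hY : Y ≠ 0) (x : ℝ) : (x : ℂ) + Y * Complex.I ≠ 0 := by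
  intro h
  apply hY
  simpa using congrArg Complex.im h

lemma jk_neg (Y : ℝ) (hY : Y < 0) :
    Tendsto (fun R : ℝ => ∫ x in (-R)..R, Complex.exp (Complex.I * ((x : ℂ) + Y * Complex.I)) /
      ((x : ℂ) + Y * Complex.I)) atTop (nhds (2 * Real.pi * Complex.I)) := by
  set g : ℂ → ℂ := dslope (fun z => Complex.exp (Complex.I * z)) 0 with hg
  have hgd : Differentiable ℂ g := by
    have : DifferentiableOn ℂ g Set.univ := by
      rw [hg, Complex.differentiableOn_dslope univ_mem]
      exact Differentiable.differentiableOn (by fun_prop)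
    exact differentiableOn_univ.mp this
  have hgz : ∀ z : ℂ, z ≠ 0 → g z = Complex.exp (Complex.I * z) / z - z⁻¹ := by
    intro z hz
    rw [hg, dslope_of_ne _ hz, slope_def_field]
    simp [sub_div]
  -- decomposition on a line
  have hline : ∀ y : ℝ, y ≠ 0 → ∀ R : ℝ, ∫ x in (-R)..R, g (x + y * Complex.I) =
      (∫ x in (-R)..R, Complex.exp (Complex.I * ((x : ℂ) + y * Complex.I)) /
        ((x : ℂ) + y * Complex.I)) - ∫ x in (-R)..R, ((x : ℂ) - (-(y * Complex.I)))⁻¹ := by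
    intro y hy R
    have hne := jk_line_ne y hy
    rw [← intervalIntegral.integral_sub]
    · refine intervalIntegral.integral_congr fun x _ => ?_
      simp only [sub_neg_eq_add]
      exact hgz _ (hne x)
    · apply Continuous.intervalIntegrable
      fun_prop (disch := assumption)
    · apply Continuous.intervalIntegrable
      simp only [sub_neg_eq_add]
      fun_prop (disch := assumption)
  have hside : ∀ ε : ℝ, |ε| = 1 → Tendsto (fun R : ℝ => ∫ y in Y..1,
      g (((ε * R : ℝ) : ℂ) + y * Complex.I)) atTop (nhds 0) := by
    intro ε hε
    have hb : Tendsto (fun R : ℝ => (Real.exp (-Y) + 1) / R * |1 - Y|) atTop (nhds 0) := by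
      have : Tendsto (fun R : ℝ => (Real.exp (-Y) + 1) / R) atTop (nhds 0) :=
        tendsto_const_nhds.div_atTop tendsto_id
      simpa using this.mul_const (|1 - Y|)
    refine squeeze_zero_norm' ?_ hb
    filter_upwards [eventually_gt_atTop 0] with R hR
    refine intervalIntegral.norm_integral_le_of_norm_le_const fun y hy => ?_
    rw [Set.uIoc_of_le (by linarith)] at hy
    have h1 := jk_norm_ge_re (ε * R) y
    rw [abs_mul, hε, one_mul, abs_of_pos hR] at h1
    have hne : (((ε * R : ℝ) : ℂ) + y * Complex.I) ≠ 0 := by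
      intro h
      rw [h, norm_zero] at h1
      linarith
    rw [hgz _ hne, inv_eq_one_div, ← sub_div, norm_div]
    gcongr
    refine (norm_sub_le _ _).trans ?_
    rw [jk_norm_exp, norm_one]
    gcongr
    exact hy.1.le
  have h1 : Tendsto (fun R : ℝ => ∫ x in (-R)..R, g (x + (1 : ℝ) * Complex.I)) atTop
      (nhds (0 - ((-1 : ℝ) : ℂ) * Real.pi * Complex.I)) := by
    simp_rw [hline 1 one_ne_zero]
    exact (jk_pos 1 one_pos).sub (jk_symm _ (-1) (Or.inr rfl) (by simp))
  have h2 : Tendsto (fun R : ℝ => ∫ x in (-R)..R, g (x + Y * Complex.I)) atTop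
      (nhds (0 - ((-1 : ℝ) : ℂ) * Real.pi * Complex.I - Complex.I * 0 + Complex.I * 0)) := by
    have := (h1.sub ((hside 1 (by simp)).const_mul Complex.I)).add
      ((hside (-1) (by simp)).const_mul Complex.I)
    refine this.congr fun R => ?_
    rw [jk_rect g R Y 1 hgd.differentiableOn]
    simp
  have h3 := h2.add (jk_symm (-(Y * Complex.I)) 1 (Or.inl rfl) (by simpa using hY))
  have e : (0 - ((-1 : ℝ) : ℂ) * Real.pi * Complex.I - Complex.I * 0 + Complex.I * 0) +
      ((1 : ℝ) : ℂ) * Real.pi * Complex.I = 2 * Real.pi * Complex.I := by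
    push_cast; ring
  rw [e] at h3
  refine h3.congr fun R => ?_
  rw [hline Y hY.ne R]
  ring

/-- the residue coefficient at `Q_j` -/
noncomputable def jkRes {n : ℕ} (a b : Fin n → ℝ) (p : MvPolynomial (Fin 2) ℂ) (j : Fin n) : ℂ :=
  MvPolynomial.eval ![((-(b j / a j) : ℝ) : ℂ), 1] p /
    ((a j : ℂ) * ∏ l ∈ Finset.univ.erase j, ((b l : ℂ) - (a l : ℂ) * ((b j / a j : ℝ) : ℂ)))

lemma jk_dehom (m : ℕ) (p : MvPolynomial (Fin 2) ℂ) (hp : p.IsHomogeneous m) :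
    ∃ P : Polynomial ℂ, P.natDegree ≤ m ∧ (∀ t, P.eval t = MvPolynomial.eval ![t, 1] p) ∧
      ∀ z₁ z₂ : ℂ, z₂ ≠ 0 → MvPolynomial.eval ![z₁, z₂] p = z₂ ^ m * P.eval (z₁ / z₂) := by
  have hdeg : ∀ d ∈ p.support, d 0 + d 1 = m := by
    intro d hd
    have := hp (MvPolynomial.mem_support_iff.mp hd)
    rw [Finsupp.weight_apply, Finsupp.sum_fintype _ _ (by simp)] at this
    simpa [Fin.sum_univ_two] using this
  refine ⟨∑ d ∈ p.support, Polynomial.C (p.coeff d) * Polynomial.X ^ (d 0), ?_, ?_, ?_⟩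
  · refine Polynomial.natDegree_sum_le_of_forall_le _ _ fun d hd => ?_
    refine (Polynomial.natDegree_C_mul_X_pow_le _ _).trans ?_
    have := hdeg d hd
    omega
  · intro t
    rw [MvPolynomial.eval_eq', Polynomial.eval_finsetSum]
    simp [Fin.prod_univ_two]
  · intro z₁ z₂ hz
    rw [MvPolynomial.eval_eq', Polynomial.eval_finsetSum, Finset.mul_sum]
    refine Finset.sum_congr rfl fun d hd => ?_
    have := hdeg d hd
    simp only [Fin.prod_univ_two, Polynomial.eval_mul, Polynomial.eval_C, Polynomial.eval_pow,
      Polynomial.eval_X, Matrix.cons_val_zero, Matrix.cons_val_one]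
    rw [← this, pow_add, div_pow]
    field_simp

lemma jk_res_eq {n : ℕ} (a b : Fin n → ℝ) (ha : ∀ j, a j ≠ 0) (p : MvPolynomial (Fin 2) ℂ)
    (P : Polynomial ℂ) (hP : ∀ t, P.eval t = MvPolynomial.eval ![t, 1] p) (j : Fin n) :
    jkRes a b p j = (∏ l, (a l : ℂ))⁻¹ * (P.eval ((-(b j / a j) : ℝ) : ℂ) /
      ∏ l ∈ Finset.univ.erase j, (((-(b j / a j) : ℝ) : ℂ) - ((-(b l / a l) : ℝ) : ℂ))) := by
  have hac : ∀ l, (a l : ℂ) ≠ 0 := fun l => by exact_mod_cast ha l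
  have h1 : ∏ l ∈ Finset.univ.erase j, ((b l : ℂ) - (a l : ℂ) * ((b j / a j : ℝ) : ℂ))
      = (∏ l ∈ Finset.univ.erase j, (a l : ℂ)) *
        ∏ l ∈ Finset.univ.erase j, (((-(b j / a j) : ℝ) : ℂ) - ((-(b l / a l) : ℝ) : ℂ)) := by
    rw [← Finset.prod_mul_distrib]
    refine Finset.prod_congr rfl fun l _ => ?_
    have := hac l
    have := hac j
    push_cast
    field_simp
    ring
  rw [jkRes, h1, ← mul_assoc, Finset.mul_prod_erase _ (fun l => (a l : ℂ)) (Finset.mem_univ j), hP,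
    div_mul_eq_div_div, div_eq_mul_inv, div_eq_mul_inv, div_eq_mul_inv]
  ring

lemma jk_nodes_inj {n : ℕ} (a b : Fin n → ℝ)
    (hratio : Function.Injective (fun j => b j / a j)) :
    Function.Injective (fun j => ((-(b j / a j) : ℝ) : ℂ)) := by
  intro i j h
  have h' : (-(b i / a i) : ℝ) = -(b j / a j) := Complex.ofReal_injective h
  exact hratio (neg_injective h')

lemma jk_sum_res (n : ℕ) (hn : 2 ≤ n) (a b : Fin n → ℝ)
    (ha : ∀ j, a j ≠ 0) (hratio : Function.Injective (fun j => b j / a j))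
    (p : MvPolynomial (Fin 2) ℂ) (hp : p.IsHomogeneous (n - 2)) :
    ∑ j, jkRes a b p j = 0 := by
  obtain ⟨P, hd, hP, -⟩ := jk_dehom _ p hp
  simp_rw [jk_res_eq a b ha p P hP]
  have hlt : P.degree < #(Finset.univ : Finset (Fin n)) := by
    rw [Finset.card_univ, Fintype.card_fin]
    refine lt_of_le_of_lt Polynomial.degree_le_natDegree ?_
    exact_mod_cast (by omega : P.natDegree < n)
  have := Lagrange.coeff_eq_sum (s := Finset.univ) (jk_nodes_inj a b hratio).injOn hlt
  rw [← Finset.mul_sum, ← this, Polynomial.coeff_eq_zero_of_natDegree_lt, mul_zero]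
  rw [Finset.card_univ, Fintype.card_fin]
  omega

lemma jk_pf (n : ℕ) (hn : 2 ≤ n) (a b : Fin n → ℝ)
    (ha : ∀ j, a j ≠ 0) (hratio : Function.Injective (fun j => b j / a j))
    (p : MvPolynomial (Fin 2) ℂ) (hp : p.IsHomogeneous (n - 2)) (z₁ z₂ : ℂ) (hz : z₂ ≠ 0)
    (hz1 : ∀ j, z₁ ≠ ((-(b j / a j) : ℝ) : ℂ) * z₂) :
    MvPolynomial.eval ![z₁, z₂] p / ∏ j, ((a j : ℂ) * z₁ + (b j : ℂ) * z₂) =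
      z₂⁻¹ * ∑ j, jkRes a b p j * (z₁ - ((-(b j / a j) : ℝ) : ℂ) * z₂)⁻¹ := by
  obtain ⟨P, hd, hP, hhom⟩ := jk_dehom _ p hp
  simp_rw [jk_res_eq a b ha p P hP]
  have hac : ∀ l, (a l : ℂ) ≠ 0 := fun l => by exact_mod_cast ha l
  set v : Fin n → ℂ := fun j => ((-(b j / a j) : ℝ) : ℂ) with hv
  have hlt : P.degree < #(Finset.univ : Finset (Fin n)) := by
    rw [Finset.card_univ, Fintype.card_fin]
    refine lt_of_le_of_lt Polynomial.degree_le_natDegree ?_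
    exact_mod_cast (by omega : P.natDegree < n)
  have hint := Lagrange.eq_interpolate (s := Finset.univ) (v := v)
    (jk_nodes_inj a b hratio).injOn hlt
  have ht : ∀ i ∈ (Finset.univ : Finset (Fin n)), z₁ / z₂ ≠ v i := by
    intro i _ h
    exact hz1 i ((div_eq_iff hz).mp h)
  have hev := Lagrange.eval_interpolate_not_at_node (fun i => P.eval (v i)) ht
  rw [← hint, Lagrange.eval_nodal] at hev
  have hprod : ∏ j, ((a j : ℂ) * z₁ + (b j : ℂ) * z₂) =
      (∏ j, (a j : ℂ)) * z₂ ^ n * ∏ j, (z₁ / z₂ - v j) := by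
    have : z₂ ^ n = ∏ _j : Fin n, z₂ := by simp
    rw [this, ← Finset.prod_mul_distrib, ← Finset.prod_mul_distrib]
    refine Finset.prod_congr rfl fun j _ => ?_
    have := hac j
    simp only [hv]
    push_cast
    field_simp
    ring
  have hA : ∏ j, (a j : ℂ) ≠ 0 := Finset.prod_ne_zero_iff.mpr fun j _ => hac j
  have hN : ∏ j, (z₁ / z₂ - v j) ≠ 0 :=
    Finset.prod_ne_zero_iff.mpr fun j hj => sub_ne_zero.mpr (ht j hj)
  have hsum : ∑ j, (∏ l, (a l : ℂ))⁻¹ * (P.eval (v j) /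
      ∏ l ∈ Finset.univ.erase j, (v j - v l)) * (z₁ - v j * z₂)⁻¹ =
      (∏ l, (a l : ℂ))⁻¹ * z₂⁻¹ * ∑ i, Lagrange.nodalWeight Finset.univ v i *
        (z₁ / z₂ - v i)⁻¹ * P.eval (v i) := by
    rw [Finset.mul_sum]
    refine Finset.sum_congr rfl fun j _ => ?_
    have e : z₁ - v j * z₂ = z₂ * (z₁ / z₂ - v j) := by field_simp
    rw [Lagrange.nodalWeight, Finset.prod_inv_distrib, e, mul_inv]
    ring
  rw [hhom _ _ hz, hev, hprod]
  refine Eq.trans ?_ (congrArg (fun s => z₂⁻¹ * s) hsum.symm)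
  obtain ⟨k, rfl⟩ : ∃ k, n = k + 2 := ⟨n - 2, by omega⟩
  have : k + 2 - 2 = k := by omega
  rw [this]
  generalize ∏ j, (z₁ / z₂ - v j) = N at hN ⊢
  generalize ∏ j, (a j : ℂ) = A at hA ⊢
  generalize ∑ i, Lagrange.nodalWeight Finset.univ v i * (z₁ / z₂ - v i)⁻¹ * P.eval (v i) = T
  field_simp
  ring

lemma jk_inner (n : ℕ) (hn : 2 ≤ n) (a b : Fin n → ℝ)
    (ha : ∀ j, a j ≠ 0) (hratio : Function.Injective (fun j => b j / a j))
    (Y₁ Y₂ : ℝ) (hY₂ : Y₂ ≠ 0) (hY₁ : ∀ j, Y₁ ≠ -(b j / a j) * Y₂)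
    (p : MvPolynomial (Fin 2) ℂ) (hp : p.IsHomogeneous (n - 2)) (x₂ : ℝ) :
    Integrable (fun x₁ : ℝ =>
        MvPolynomial.eval ![(x₁ : ℂ) + Complex.I * (Y₁ : ℂ), (x₂ : ℂ) + Complex.I * (Y₂ : ℂ)] p /
          ∏ j, ((a j : ℂ) * ((x₁ : ℂ) + Complex.I * (Y₁ : ℂ)) +
            (b j : ℂ) * ((x₂ : ℂ) + Complex.I * (Y₂ : ℂ)))) ∧
    ∫ x₁ : ℝ,
        MvPolynomial.eval ![(x₁ : ℂ) + Complex.I * (Y₁ : ℂ), (x₂ : ℂ) + Complex.I * (Y₂ : ℂ)] p /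
          ∏ j, ((a j : ℂ) * ((x₁ : ℂ) + Complex.I * (Y₁ : ℂ)) +
            (b j : ℂ) * ((x₂ : ℂ) + Complex.I * (Y₂ : ℂ))) =
      ((x₂ : ℂ) + Complex.I * (Y₂ : ℂ))⁻¹ * (2 * Real.pi * Complex.I *
        ∑ j ∈ Finset.univ.filter (fun j => Y₁ < -(b j / a j) * Y₂), jkRes a b p j) := by
  set z₂ : ℂ := (x₂ : ℂ) + Complex.I * (Y₂ : ℂ) with hz₂
  have hz : z₂ ≠ 0 := by
    intro h
    apply hY₂
    simpa [hz₂] using congrArg Complex.im h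
  set w : Fin n → ℂ := fun j => ((-(b j / a j) : ℝ) : ℂ) * z₂ - Complex.I * (Y₁ : ℂ) with hw
  have hwim : ∀ j, (w j).im = -(b j / a j) * Y₂ - Y₁ := by
    intro j
    simp only [hw, hz₂, Complex.sub_im, Complex.im_ofReal_mul]
    simp
  have hw0 : ∀ j, (w j).im ≠ 0 := fun j => by
    rw [hwim]
    exact sub_ne_zero.mpr (hY₁ j).symm
  have hf : (fun x₁ : ℝ =>
        MvPolynomial.eval ![(x₁ : ℂ) + Complex.I * (Y₁ : ℂ), z₂] p /
          ∏ j, ((a j : ℂ) * ((x₁ : ℂ) + Complex.I * (Y₁ : ℂ)) + (b j : ℂ) * z₂)) =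
      fun x₁ : ℝ => z₂⁻¹ * ∑ j, jkRes a b p j *
        (((x₁ : ℂ) - w j)⁻¹ - (x₁ : ℂ) / (1 + (x₁ : ℂ) ^ 2)) := by
    funext x₁
    rw [jk_pf n hn a b ha hratio p hp _ _ hz]
    · simp_rw [mul_sub]
      rw [Finset.sum_sub_distrib, ← Finset.sum_mul, jk_sum_res n hn a b ha hratio p hp, zero_mul,
        sub_zero]
      congr 1
      refine Finset.sum_congr rfl fun j _ => ?_
      congr 2
      simp only [hw]
      ring
    · intro j h
      apply jk_den_ne (w j) (hw0 j) x₁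
      simp only [hw]
      rw [← h]
      ring
  rw [hf]
  have hi : ∀ j ∈ (Finset.univ : Finset (Fin n)), Integrable (fun x₁ : ℝ => jkRes a b p j *
        (((x₁ : ℂ) - w j)⁻¹ - (x₁ : ℂ) / (1 + (x₁ : ℂ) ^ 2))) := fun j _ =>
    (jk_integrable (w j) (hw0 j)).const_mul _
  refine ⟨(integrable_finsetSum _ hi).const_mul _, ?_⟩
  rw [MeasureTheory.integral_const_mul, integral_finsetSum _ hi]
  congr 1
  have hj : ∀ j, ∫ x₁ : ℝ, jkRes a b p j *
        (((x₁ : ℂ) - w j)⁻¹ - (x₁ : ℂ) / (1 + (x₁ : ℂ) ^ 2)) =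
      2 * Real.pi * Complex.I * (if Y₁ < -(b j / a j) * Y₂ then jkRes a b p j else 0)
        - Real.pi * Complex.I * jkRes a b p j := by
    intro j
    rw [MeasureTheory.integral_const_mul]
    have h0 := hwim j
    by_cases h : Y₁ < -(b j / a j) * Y₂
    · rw [if_pos h, jk_integral (w j) 1 (Or.inl rfl) (by rw [h0]; linarith)]
      push_cast
      ring
    · have h' : -(b j / a j) * Y₂ < Y₁ := lt_of_le_of_ne (not_lt.mp h) (hY₁ j).symm
      rw [if_neg h, jk_integral (w j) (-1) (Or.inr rfl) (by rw [h0]; linarith)]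
      push_cast
      ring
  simp_rw [hj]
  rw [Finset.sum_sub_distrib, ← Finset.mul_sum, ← Finset.mul_sum,
    jk_sum_res n hn a b ha hratio p hp, Finset.sum_filter]
  simp

lemma jk_outer (n : ℕ) (hn : 2 ≤ n) (a b : Fin n → ℝ)
    (ha : ∀ j, a j ≠ 0) (hratio : Function.Injective (fun j => b j / a j))
    (Y₁ Y₂ : ℝ) (hY₂ : Y₂ ≠ 0) (hY₁ : ∀ j, Y₁ ≠ -(b j / a j) * Y₂)
    (p : MvPolynomial (Fin 2) ℂ) (hp : p.IsHomogeneous (n - 2)) (R : ℝ) :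
    ∫ x₂ in (-R)..R, ∫ x₁ : ℝ,
        Complex.exp (Complex.I * ((x₂ : ℂ) + Complex.I * (Y₂ : ℂ))) *
          MvPolynomial.eval ![(x₁ : ℂ) + Complex.I * (Y₁ : ℂ), (x₂ : ℂ) + Complex.I * (Y₂ : ℂ)] p /
          ∏ j, ((a j : ℂ) * ((x₁ : ℂ) + Complex.I * (Y₁ : ℂ)) +
            (b j : ℂ) * ((x₂ : ℂ) + Complex.I * (Y₂ : ℂ))) =
      (∫ x in (-R)..R, Complex.exp (Complex.I * ((x : ℂ) + Y₂ * Complex.I)) /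
        ((x : ℂ) + Y₂ * Complex.I)) * (2 * Real.pi * Complex.I *
        ∑ j ∈ Finset.univ.filter (fun j => Y₁ < -(b j / a j) * Y₂), jkRes a b p j) := by
  rw [← intervalIntegral.integral_mul_const]
  refine intervalIntegral.integral_congr fun x₂ _ => ?_
  simp only [mul_div_assoc]
  rw [MeasureTheory.integral_const_mul, (jk_inner n hn a b ha hratio Y₁ Y₂ hY₂ hY₁ p hp x₂).2,
    mul_comm (Y₂ : ℂ) Complex.I]
  ring

/-- The rank-two Jeffrey–Kirwan iterated residue integral for weights
`λ^j(z₁, z₂) = a_j z₁ + b_j z₂` on `ℂ²`, with shift `(Y₁, Y₂)` and a homogeneous polynomial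
`p` of degree `n - 2`: the inner integral over `x₁` converges absolutely, and the iterated
integral equals `(2πi)²` times the sum over `S = {j : -(b_j/a_j) Y₂ > Y₁}` of
`p(Q_j) / (a_j ∏_{l ≠ j} (b_l - a_l b_j/a_j))`, where `Q_j = (-b_j/a_j, 1)`, if `Y₂ < 0`,
and equals `0` if `Y₂ > 0`. -/
theorem jk_residue_rank_two (n : ℕ) (hn : 2 ≤ n) (a b : Fin n → ℝ)
    (ha : ∀ j, a j ≠ 0) (hratio : Function.Injective (fun j => b j / a j))
    (Y₁ Y₂ : ℝ) (hY₂ : Y₂ ≠ 0) (hY₁ : ∀ j, Y₁ ≠ -(b j / a j) * Y₂)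
    (p : MvPolynomial (Fin 2) ℂ) (hp : p.IsHomogeneous (n - 2)) :
    (∀ x₂ : ℝ, Integrable (fun x₁ : ℝ =>
        MvPolynomial.eval ![(x₁ : ℂ) + Complex.I * (Y₁ : ℂ), (x₂ : ℂ) + Complex.I * (Y₂ : ℂ)] p /
          ∏ j, ((a j : ℂ) * ((x₁ : ℂ) + Complex.I * (Y₁ : ℂ)) +
            (b j : ℂ) * ((x₂ : ℂ) + Complex.I * (Y₂ : ℂ))))) ∧
    (Y₂ < 0 → Tendsto (fun R : ℝ => ∫ x₂ in (-R)..R, ∫ x₁ : ℝ,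
        Complex.exp (Complex.I * ((x₂ : ℂ) + Complex.I * (Y₂ : ℂ))) *
          MvPolynomial.eval ![(x₁ : ℂ) + Complex.I * (Y₁ : ℂ), (x₂ : ℂ) + Complex.I * (Y₂ : ℂ)] p /
          ∏ j, ((a j : ℂ) * ((x₁ : ℂ) + Complex.I * (Y₁ : ℂ)) +
            (b j : ℂ) * ((x₂ : ℂ) + Complex.I * (Y₂ : ℂ))))
      atTop (nhds (((2 : ℂ) * (Real.pi : ℂ) * Complex.I) ^ 2 *
        ∑ j ∈ Finset.univ.filter (fun j => Y₁ < -(b j / a j) * Y₂),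
          MvPolynomial.eval ![((-(b j / a j) : ℝ) : ℂ), 1] p /
            ((a j : ℂ) * ∏ l ∈ Finset.univ.erase j,
              ((b l : ℂ) - (a l : ℂ) * ((b j / a j : ℝ) : ℂ)))))) ∧
    (0 < Y₂ → Tendsto (fun R : ℝ => ∫ x₂ in (-R)..R, ∫ x₁ : ℝ,
        Complex.exp (Complex.I * ((x₂ : ℂ) + Complex.I * (Y₂ : ℂ))) *
          MvPolynomial.eval ![(x₁ : ℂ) + Complex.I * (Y₁ : ℂ), (x₂ : ℂ) + Complex.I * (Y₂ : ℂ)] p /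
          ∏ j, ((a j : ℂ) * ((x₁ : ℂ) + Complex.I * (Y₁ : ℂ)) +
            (b j : ℂ) * ((x₂ : ℂ) + Complex.I * (Y₂ : ℂ))))
      atTop (nhds 0)) := by
  refine ⟨fun x₂ => (jk_inner n hn a b ha hratio Y₁ Y₂ hY₂ hY₁ p hp x₂).1, fun h => ?_, fun h => ?_⟩
  · simp_rw [jk_outer n hn a b ha hratio Y₁ Y₂ hY₂ hY₁ p hp]
    have := (jk_neg Y₂ h).mul_const (2 * Real.pi * Complex.I *
        ∑ j ∈ Finset.univ.filter (fun j => Y₁ < -(b j / a j) * Y₂), jkRes a b p j)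
    refine this.trans (le_of_eq ?_)
    congr 1
    simp only [jkRes]
    ring
  · simp_rw [jk_outer n hn a b ha hratio Y₁ Y₂ hY₂ hY₁ p hp]
    simpa using (jk_pos Y₂ h).mul_const (2 * Real.pi * Complex.I *
        ∑ j ∈ Finset.univ.filter (fun j => Y₁ < -(b j / a j) * Y₂), jkRes a b p j)
end

section
/- Let n ≥ 2, let m_1, …, m_n be distinct nonzero real numbers, let k be an integer with 0 ≤ k ≤ n − 2, and let Y_2 < 0 be a real number. Then (1/(2πi)²) · lim_{R→∞} ∫_{−R}^{R} [ ∫_ℝ e^{i(x_2+iY_2)} · x_1^k (x_2+iY_2)^{n−2−k} / ∏_{j=1}^n ( x_1 + m_j (x_2+iY_2) ) dx_1 ] dx_2 = Σ_{j : m_j > 0} (−m_j)^k / ∏_{l ≠ j} (m_l − m_j). -/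
open MeasureTheory Filter Finset intervalIntegral

lemma jk_ne (a : ℂ) (ha : a.im ≠ 0) (x : ℝ) : (x : ℂ) + a ≠ 0 := by
  intro h
  have := congrArg Complex.im h
  simp at this
  exact ha this

lemma jk_cont (a : ℂ) (ha : a.im ≠ 0) : Continuous fun x : ℝ => ((x : ℂ) + a)⁻¹ :=
  (by fun_prop : Continuous fun x : ℝ => (x : ℂ) + a).inv₀ (jk_ne a ha)

lemma jk_memLp (a : ℂ) (ha : a.im ≠ 0) : MemLp (fun x : ℝ => ((x : ℂ) + a)⁻¹) 2 volume := by
  rw [memLp_two_iff_integrable_sq_norm (jk_cont a ha).aestronglyMeasurable]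
  have h := ((integrable_inv_one_add_sq.comp_div ha).comp_add_right a.re).const_mul ((a.im ^ 2)⁻¹)
  refine h.congr (Eventually.of_forall fun x => ?_)
  simp only [norm_inv, inv_pow, ← Complex.normSq_eq_norm_sq, Complex.normSq_apply, Complex.add_re,
    Complex.add_im, Complex.ofReal_re, Complex.ofReal_im]
  rw [← mul_inv]
  congr 1
  field_simp
  ring

lemma jk_int2 (a b : ℂ) (ha : a.im ≠ 0) (hb : b.im ≠ 0) :
    Integrable (fun x : ℝ => ((x : ℂ) + a)⁻¹ * ((x : ℂ) + b)⁻¹) :=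
  (jk_memLp a ha).integrable_mul (jk_memLp b hb)

lemma jk_log_int (a : ℂ) (ha : a.im ≠ 0) (R : ℝ) :
    ∫ x in (-R)..R, ((x : ℂ) + a)⁻¹ = Complex.log (R + a) - Complex.log (-R + a) := by
  have := integral_eq_sub_of_hasDerivAt (a := -R) (b := R)
    (f := fun x : ℝ => Complex.log (x + a)) (f' := fun x : ℝ => ((x : ℂ) + a)⁻¹)
    (fun x _ => by
      have h1 : HasDerivAt (fun x : ℝ => (x : ℂ) + a) 1 x :=
        (Complex.ofRealCLM.hasDerivAt (x := x)).add_const a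
      have := h1.clog_real (Or.inr (by simpa using ha))
      simpa using this)
    ((jk_cont a ha).intervalIntegrable _ _)
  simpa using this

lemma jk_log_lim (a : ℂ) (ha : a.im ≠ 0) :
    Tendsto (fun R : ℝ => ∫ x in (-R)..R, ((x : ℂ) + a)⁻¹) atTop
      (nhds ((if a.im < 0 then 1 else -1) * (Real.pi * Complex.I))) := by
  simp_rw [jk_log_int a ha]
  have hinv : Tendsto (fun R : ℝ => a / (R : ℂ)) atTop (nhds 0) := by
    have : Tendsto (fun R : ℝ => ((R⁻¹ : ℝ) : ℂ)) atTop (nhds ((0 : ℝ) : ℂ)) :=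
      (Complex.continuous_ofReal.tendsto 0).comp tendsto_inv_atTop_zero
    simpa [div_eq_mul_inv] using this.const_mul a
  have h1 : Tendsto (fun R : ℝ => Complex.log (1 + a / (R : ℂ))) atTop (nhds 0) := by
    have h : Tendsto (fun R : ℝ => 1 + a / (R : ℂ)) atTop (nhds 1) := by
      simpa using hinv.const_add 1
    simpa using h.clog (by simp)
  have h2 : Tendsto (fun R : ℝ => -1 + a / (R : ℂ)) atTop (nhds (-1)) := by
    simpa using hinv.const_add (-1)
  have h3 : Tendsto (fun R : ℝ => Complex.log (-1 + a / (R : ℂ))) atTop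
      (nhds (-(if a.im < 0 then 1 else -1) * (Real.pi * Complex.I))) := by
    have him : ∀ R : ℝ, (-1 + a / (R : ℂ)).im = a.im / R := by
      intro R
      simp [Complex.div_ofReal_im]
    split_ifs with h
    · have := (Complex.tendsto_log_nhdsWithin_im_neg_of_re_neg_of_im_zero (z := -1)
        (by simp) (by simp)).comp (tendsto_nhdsWithin_iff.2 ⟨h2, by
          filter_upwards [eventually_gt_atTop 0] with R hR
          show (-1 + a / (R : ℂ)).im < 0
          rw [him]
          exact div_neg_of_neg_of_pos h hR⟩)
      simpa [Function.comp_def] using this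
    · have := (Complex.tendsto_log_nhdsWithin_im_nonneg_of_re_neg_of_im_zero (z := -1)
        (by simp) (by simp)).comp (tendsto_nhdsWithin_iff.2 ⟨h2, by
          filter_upwards [eventually_gt_atTop 0] with R hR
          show 0 ≤ (-1 + a / (R : ℂ)).im
          rw [him]
          exact div_nonneg (not_lt.1 h) hR.le⟩)
      simpa [Function.comp_def] using this
  have h4 := h1.sub h3
  rw [zero_sub, ← neg_mul, neg_neg] at h4
  refine h4.congr' ?_
  filter_upwards [eventually_gt_atTop 0] with R hR
  have hR0 : (R : ℂ) ≠ 0 := by exact_mod_cast hR.ne'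
  have e1 : (R : ℂ) + a = R * (1 + a / R) := by field_simp
  have e2 : -(R : ℂ) + a = R * (-1 + a / R) := by field_simp
  have n1 := jk_ne a ha R
  have n2 := jk_ne a ha (-R)
  push_cast at n2
  rw [e1] at n1 ⊢
  rw [e2] at n2 ⊢
  rw [Complex.log_ofReal_mul hR (right_ne_zero_of_mul n1),
    Complex.log_ofReal_mul hR (right_ne_zero_of_mul n2)]
  ring

lemma jk_inner_s12 (n : ℕ) (a : Fin n → ℂ) (hinj : Function.Injective a) (ha : ∀ j, (a j).im ≠ 0)
    (k : ℕ) (hk : k + 2 ≤ n) :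
    ∫ x : ℝ, (x : ℂ) ^ k / ∏ j, ((x : ℂ) + a j) =
      2 * Real.pi * Complex.I * ∑ j ∈ Finset.univ.filter (fun j => (a j).im < 0),
        (-a j) ^ k / ∏ l ∈ Finset.univ.erase j, (a l - a j) := by
  set c : Fin n → ℂ := fun j => (-a j) ^ k / ∏ l ∈ Finset.univ.erase j, (a l - a j) with hc
  have hv : Set.InjOn (fun j => - a j) (Finset.univ : Finset (Fin n)) :=
    fun x _ y _ h => hinj (neg_injective h)
  have hw : ∀ j, Lagrange.nodalWeight Finset.univ (fun j => - a j) j =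
      (∏ l ∈ Finset.univ.erase j, (a l - a j))⁻¹ := by
    intro j
    rw [Lagrange.nodalWeight, Finset.prod_inv_distrib]
    congr 1
    exact Finset.prod_congr rfl fun l _ => by ring
  have key : ∀ (p : ℕ) (hp : p < n) (x : ℝ), (x : ℂ) ^ p = (∏ j, ((x : ℂ) + a j)) *
      ∑ i, (∏ l ∈ Finset.univ.erase i, (a l - a i))⁻¹ * ((x : ℂ) + a i)⁻¹ * (- a i) ^ p := by
    intro p hp x
    have h1 := Lagrange.eq_interpolate (f := (Polynomial.X : Polynomial ℂ) ^ p) hv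
      (by rw [Polynomial.degree_X_pow]; simpa using hp)
    have h2 := congrArg (Polynomial.eval (x : ℂ)) h1
    rw [Lagrange.eval_interpolate_not_at_node _ (fun i _ h => jk_ne _ (ha i) x (by rw [h]; ring)),
      Lagrange.eval_nodal] at h2
    simpa [hw] using h2
  have hprod : ∀ x : ℝ, (∏ j, ((x : ℂ) + a j)) ≠ 0 := fun x =>
    Finset.prod_ne_zero_iff.2 fun j _ => jk_ne _ (ha j) x
  have hpf : ∀ x : ℝ, (x : ℂ) ^ k / ∏ j, ((x : ℂ) + a j) = ∑ j, c j * ((x : ℂ) + a j)⁻¹ := by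
    intro x
    rw [div_eq_iff (hprod x), mul_comm]
    rw [key k (by omega) x]
    congr 1
    exact Finset.sum_congr rfl fun j _ => by simp only [hc]; ring
  have hsum : ∑ j, c j = 0 := by
    have h := key (k + 1) (by omega) 0
    rw [Complex.ofReal_zero, zero_pow (by omega)] at h
    have h' := (mul_eq_zero.1 h.symm).resolve_left (by simpa using hprod 0)
    rw [← neg_eq_zero, ← h', ← Finset.sum_neg_distrib]
    refine Finset.sum_congr rfl fun j _ => ?_
    have : a j ≠ 0 := by simpa using jk_ne _ (ha j) 0
    simp only [hc, zero_add, pow_succ]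
    field_simp
  let j0 : Fin n := ⟨0, by omega⟩
  have hint : Integrable (fun x : ℝ => ∑ j, c j * ((x : ℂ) + a j)⁻¹) := by
    have : (fun x : ℝ => ∑ j, c j * ((x : ℂ) + a j)⁻¹) = fun x : ℝ =>
        ∑ j, (c j * (a j0 - a j)) * (((x : ℂ) + a j)⁻¹ * ((x : ℂ) + a j0)⁻¹) := by
      funext x
      rw [← sub_zero (∑ j, c j * ((x : ℂ) + a j)⁻¹), ← zero_mul ((x : ℂ) + a j0)⁻¹, ← hsum,
        Finset.sum_mul, ← Finset.sum_sub_distrib]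
      refine Finset.sum_congr rfl fun j _ => ?_
      have n1 := jk_ne _ (ha j) x
      have n2 := jk_ne _ (ha j0) x
      field_simp
      ring
    rw [this]
    exact integrable_finsetSum _ fun j _ => (jk_int2 _ _ (ha j) (ha j0)).const_mul _
  simp_rw [hpf]
  have L1 := intervalIntegral_tendsto_integral hint tendsto_neg_atTop_atBot tendsto_id
  have L2 : Tendsto (fun R : ℝ => ∫ x in (-R)..R, ∑ j, c j * ((x : ℂ) + a j)⁻¹) atTop
      (nhds (∑ j, c j * ((if (a j).im < 0 then 1 else -1) * (Real.pi * Complex.I)))) := by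
    have : ∀ R : ℝ, ∫ x in (-R)..R, ∑ j, c j * ((x : ℂ) + a j)⁻¹ =
        ∑ j, c j * ∫ x in (-R)..R, ((x : ℂ) + a j)⁻¹ := by
      intro R
      rw [intervalIntegral.integral_finsetSum
        (fun j _ => ((jk_cont _ (ha j)).intervalIntegrable _ _).const_mul _)]
      simp
    simp_rw [this]
    exact tendsto_finsetSum _ fun j _ => (jk_log_lim _ (ha j)).const_mul _
  have hz : (∑ j, c j) * (Real.pi * Complex.I) = 0 := by rw [hsum, zero_mul]
  rw [tendsto_nhds_unique L1 L2, ← add_zero (∑ j, _), ← hz, Finset.sum_mul,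
    ← Finset.sum_add_distrib, Finset.sum_filter, Finset.mul_sum]
  refine Finset.sum_congr rfl fun j _ => ?_
  split_ifs <;> ring

lemma jk_gamma (r : ℂ) (hr : 0 < r.re) :
    IntegrableOn (fun t : ℝ => (t : ℂ) * Complex.exp (-(r * t))) (Set.Ioi 0) ∧
    ∫ t in Set.Ioi (0 : ℝ), (t : ℂ) * Complex.exp (-(r * t)) = (r ^ 2)⁻¹ := by
  have hr0 : r ≠ 0 := fun h => by simp [h] at hr
  have hn : ∀ t : ℝ, ‖Complex.exp (-(r * t))‖ = Real.exp (-r.re * t) := by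
    intro t
    rw [Complex.norm_exp]
    simp
  have hint : IntegrableOn (fun t : ℝ => (t : ℂ) * Complex.exp (-(r * t))) (Set.Ioi 0) := by
    have h := integrableOn_rpow_mul_exp_neg_mul_rpow (s := 1) (p := 1) (by norm_num) one_pos hr
    refine Integrable.mono h (Continuous.aestronglyMeasurable (by fun_prop))
      (Eventually.of_forall fun t => ?_)
    rw [norm_mul, hn, norm_mul]
    simp
  refine ⟨hint, ?_⟩
  have lim0 : ∀ s : ℝ, Tendsto (fun t : ℝ => t ^ s * Real.exp (-r.re * t)) atTop (nhds 0) :=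
    fun s => tendsto_rpow_mul_exp_neg_mul_atTop_nhds_zero s _ hr
  have T1 : Tendsto (fun t : ℝ => (t : ℂ) * Complex.exp (-(r * t))) atTop (nhds 0) := by
    rw [tendsto_zero_iff_norm_tendsto_zero]
    refine (lim0 1).congr' ?_
    filter_upwards [eventually_gt_atTop 0] with t ht
    rw [norm_mul, hn]
    simp [abs_of_pos ht]
  have T2 : Tendsto (fun t : ℝ => Complex.exp (-(r * t))) atTop (nhds 0) := by
    rw [tendsto_zero_iff_norm_tendsto_zero]
    refine (lim0 0).congr fun t => ?_
    rw [hn]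
    simp
  have T : Tendsto (fun t : ℝ => -(r⁻¹ * ((t : ℂ) * Complex.exp (-(r * t)))
      + (r ^ 2)⁻¹ * Complex.exp (-(r * t)))) atTop (nhds 0) := by
    simpa using ((T1.const_mul r⁻¹).add (T2.const_mul (r ^ 2)⁻¹)).neg
  have := integral_Ioi_of_hasDerivAt_of_tendsto' (a := 0) (fun t _ => ?_) hint T
  · rw [this]
    simp
  · have h1 : HasDerivAt (fun x : ℝ => (x : ℂ)) 1 t := Complex.ofRealCLM.hasDerivAt (x := t)
    have h2 := (h1.const_mul r).neg.cexp
    have h3 := (((h1.mul h2).const_mul r⁻¹).add (h2.const_mul (r ^ 2)⁻¹)).neg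
    refine h3.congr_deriv ?_
    simp only [Pi.neg_apply]
    field_simp
    ring

lemma jk_fourier (c : ℝ) (hc : 0 < c) :
    ∫ x : ℝ, Complex.exp (Complex.I * x) * (((x : ℂ) - Complex.I * c)⁻¹ * ((x : ℂ) - Complex.I * c)⁻¹)
      = - 2 * Real.pi * Complex.exp (-c) := by
  let f : ℝ → ℂ := (Set.Ioi 0).indicator (fun t => (t : ℂ) * Complex.exp (-(c * t)))
  have gam : ∀ r : ℂ, 0 < r.re → ∫ t in Set.Ioi (0 : ℝ), (t : ℂ) * Complex.exp (-(r * t)) =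
      (r ^ 2)⁻¹ := by
    exact fun r hr => (jk_gamma r hr).2
  have hf : Integrable f := by
    refine IntegrableOn.integrable_indicator ?_ measurableSet_Ioi
    exact (jk_gamma c (by simpa using hc)).1
  have hF : FourierTransform.fourier f = fun w : ℝ => ((c + 2 * Real.pi * Complex.I * w) ^ 2)⁻¹ := by
    funext w
    rw [Real.fourier_real_eq_integral_exp_smul, ← gam _ (by simpa using hc),
      ← MeasureTheory.integral_indicator measurableSet_Ioi]
    congr 1
    funext t
    by_cases ht : t ∈ Set.Ioi (0 : ℝ)
    · simp only [f, Set.indicator_of_mem ht, smul_eq_mul]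
      rw [mul_left_comm, ← Complex.exp_add]
      congr 2
      push_cast
      ring
    · simp [f, Set.indicator_of_notMem ht]
  have him : (-(Complex.I * c)).im ≠ 0 := by simpa using hc.ne'
  have hint : Integrable (fun x : ℝ => (((x : ℂ) - Complex.I * c)⁻¹ * ((x : ℂ) - Complex.I * c)⁻¹)) := by
    simpa [sub_eq_add_neg] using jk_int2 _ _ him him
  have hF2 : ∀ w : ℝ, ((c + 2 * Real.pi * Complex.I * w) ^ 2)⁻¹ =
     - ((((2 * Real.pi * w : ℝ) : ℂ) - Complex.I * c)⁻¹ * (((2 * Real.pi * w : ℝ) : ℂ) - Complex.I * c)⁻¹) := by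
    intro w
    have : (c + 2 * Real.pi * Complex.I * w : ℂ) = Complex.I * (((2 * Real.pi * w : ℝ) : ℂ) - Complex.I * c) := by
      push_cast
      linear_combination (c : ℂ) * Complex.I_sq
    rw [this, mul_pow, Complex.I_sq, ← mul_inv, ← sq, neg_one_mul, inv_neg]
  have h'f : Integrable (FourierTransform.fourier f) := by
    rw [hF]
    simp_rw [hF2]
    exact (hint.comp_mul_left' (by positivity : 2 * Real.pi ≠ 0)).neg
  have hcont : ContinuousAt f 1 := by
    have : (fun t : ℝ => (t : ℂ) * Complex.exp (-(c * t))) =ᶠ[nhds 1] f := by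
      filter_upwards [Ioi_mem_nhds (zero_lt_one' ℝ)] with t ht
      simp only [f, Set.indicator_of_mem ht]
    refine ContinuousAt.congr ?_ this
    fun_prop
  have inv := hf.fourierInv_fourier_eq h'f hcont
  rw [Real.fourierInv_eq', hF] at inv
  have hf1 : f 1 = Complex.exp (-c) := by simp [f]
  rw [hf1] at inv
  have := Measure.integral_comp_mul_left (fun x : ℝ => Complex.exp (Complex.I * x) * (((x : ℂ) - Complex.I * c)⁻¹ * ((x : ℂ) - Complex.I * c)⁻¹)) (2 * Real.pi)
  rw [abs_of_pos (by positivity)] at this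
  have e : ∫ v : ℝ, Complex.exp (((2 * Real.pi * inner ℝ v 1 : ℝ) : ℂ) * Complex.I) • ((c + 2 * Real.pi * Complex.I * v) ^ 2)⁻¹
     = - ∫ x : ℝ, Complex.exp (Complex.I * (2 * Real.pi * x : ℝ)) * ((((2 * Real.pi * x : ℝ) : ℂ) - Complex.I * c)⁻¹ * (((2 * Real.pi * x : ℝ) : ℂ) - Complex.I * c)⁻¹) := by
    rw [← MeasureTheory.integral_neg]
    congr 1
    funext v
    rw [hF2, smul_eq_mul, mul_neg]
    simp [mul_comm]
  rw [e, this] at inv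
  rw [← inv, Complex.real_smul]
  have : (Real.pi : ℂ) ≠ 0 := by exact_mod_cast Real.pi_ne_zero
  push_cast
  field_simp

lemma jk_outer_s12 (Y : ℝ) (hY : Y < 0) :
    Tendsto (fun R : ℝ => ∫ x in (-R)..R, Complex.exp (Complex.I * ((x : ℂ) + Complex.I * Y)) *
      ((x : ℂ) + Complex.I * Y)⁻¹) atTop (nhds (2 * Real.pi * Complex.I)) := by
  have him : (Complex.I * Y : ℂ).im ≠ 0 := by simpa using hY.ne
  have hn := jk_ne _ him
  have hci := jk_cont _ him
  have hE : ∀ x : ℝ, Complex.exp (Complex.I * ((x : ℂ) + Complex.I * Y)) =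
      Complex.exp (-Y) * Complex.exp (Complex.I * x) := by
    intro x
    rw [← Complex.exp_add]
    congr 1
    linear_combination (Y : ℂ) * Complex.I_sq
  have hEn : ∀ x : ℝ, ‖Complex.exp (Complex.I * ((x : ℂ) + Complex.I * Y))‖ = Real.exp (-Y) := by
    intro x
    rw [Complex.norm_exp]
    simp
  have hEc : Continuous fun x : ℝ => Complex.exp (Complex.I * ((x : ℂ) + Complex.I * Y)) := by
    fun_prop
  have hint : Integrable (fun x : ℝ => Complex.exp (Complex.I * ((x : ℂ) + Complex.I * Y)) *
      (((x : ℂ) + Complex.I * Y)⁻¹ * ((x : ℂ) + Complex.I * Y)⁻¹)) := by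
    refine (jk_int2 _ _ him him).bdd_mul hEc.aestronglyMeasurable
      (Eventually.of_forall fun x => (hEn x).le)
  have hval : ∫ x : ℝ, Complex.exp (Complex.I * ((x : ℂ) + Complex.I * Y)) *
      (((x : ℂ) + Complex.I * Y)⁻¹ * ((x : ℂ) + Complex.I * Y)⁻¹) = - 2 * Real.pi := by
    have h := jk_fourier (-Y) (by linarith)
    simp only [Complex.ofReal_neg, mul_neg, sub_neg_eq_add, neg_neg] at h
    simp_rw [hE, mul_assoc]
    rw [MeasureTheory.integral_const_mul, h, mul_left_comm, ← Complex.exp_add]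
    simp
  have L1 := intervalIntegral_tendsto_integral hint tendsto_neg_atTop_atBot tendsto_id
  rw [hval] at L1
  let G : ℝ → ℂ := fun x => Complex.exp (Complex.I * ((x : ℂ) + Complex.I * Y)) *
      ((x : ℂ) + Complex.I * Y)⁻¹ * (-Complex.I)
  have hG : ∀ R : ℝ, ∫ x in (-R)..R, (Complex.exp (Complex.I * ((x : ℂ) + Complex.I * Y)) *
      ((x : ℂ) + Complex.I * Y)⁻¹ + Complex.I * (Complex.exp (Complex.I * ((x : ℂ) + Complex.I * Y)) *
      (((x : ℂ) + Complex.I * Y)⁻¹ * ((x : ℂ) + Complex.I * Y)⁻¹))) = G R - G (-R) := by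
    intro R
    refine integral_eq_sub_of_hasDerivAt (fun x _ => ?_) (Continuous.intervalIntegrable ?_ _ _)
    · have h1 : HasDerivAt (fun x : ℝ => (x : ℂ) + Complex.I * Y) 1 x :=
        (Complex.ofRealCLM.hasDerivAt (x := x)).add_const _
      have h2 := (((h1.const_mul Complex.I).cexp).mul (h1.inv (hn x))).mul_const (-Complex.I)
      refine h2.congr_deriv ?_
      have := hn x
      simp only [Pi.inv_apply]
      field_simp
      linear_combination (-(x : ℂ) - Complex.I * Y) * Complex.I_sq
    · exact (hEc.mul hci).add ((hEc.mul (hci.mul hci)).const_mul _)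
  have hG0 : ∀ l : Filter ℝ, Tendsto (fun x : ℝ => |x|) l atTop → Tendsto G l (nhds 0) := by
    intro l hl
    rw [tendsto_zero_iff_norm_tendsto_zero]
    have : Tendsto (fun x : ℝ => Real.exp (-Y) * |x|⁻¹) l (nhds 0) := by
      simpa using (tendsto_inv_atTop_zero.comp hl).const_mul (Real.exp (-Y))
    refine squeeze_zero' (Eventually.of_forall fun x => norm_nonneg _) ?_ this
    filter_upwards [hl.eventually_gt_atTop 0] with x hx
    simp only [G, norm_mul, hEn, norm_inv, norm_neg, Complex.norm_I, mul_one]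
    gcongr
    have := Complex.abs_re_le_norm ((x : ℂ) + Complex.I * Y)
    simpa using this
  have L2 : Tendsto (fun R : ℝ => G R - G (-R)) atTop (nhds 0) := by
    have := (hG0 atTop tendsto_abs_atTop_atTop).sub
      ((hG0 atBot tendsto_abs_atBot_atTop).comp tendsto_neg_atTop_atBot)
    simpa using this
  have L3 := L2.sub (L1.const_mul Complex.I)
  have e : (0 : ℂ) - Complex.I * (-2 * Real.pi) = 2 * Real.pi * Complex.I := by ring
  rw [e] at L3
  refine L3.congr fun R => ?_
  have i1 : IntervalIntegrable (fun x : ℝ => Complex.exp (Complex.I * ((x : ℂ) + Complex.I * Y)) *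
      ((x : ℂ) + Complex.I * Y)⁻¹) volume (-R) R := (hEc.mul hci).intervalIntegrable _ _
  have i2 : IntervalIntegrable (fun x : ℝ => Complex.I *
      (Complex.exp (Complex.I * ((x : ℂ) + Complex.I * Y)) *
      (((x : ℂ) + Complex.I * Y)⁻¹ * ((x : ℂ) + Complex.I * Y)⁻¹))) volume (-R) R :=
    hint.intervalIntegrable.const_mul _
  rw [← hG R, intervalIntegral.integral_add i1 i2, intervalIntegral.integral_const_mul]
  simp


/-- The paper's formula (12): for the torus `S¹ × S¹` acting on `ℂⁿ` with weights `(1, m_j)`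
(the `m_j` distinct and nonzero), `0 ≤ k ≤ n - 2` and a shift `Y₂ < 0`, the iterated residue
integral equals `(2πi)²` times `Σ_{j : m_j > 0} (-m_j)^k / ∏_{l ≠ j} (m_l - m_j)`. -/
theorem jk_residue_Cn_circle_weights (n : ℕ) (hn : 2 ≤ n) (m : Fin n → ℝ)
    (hm : Function.Injective m) (hm0 : ∀ j, m j ≠ 0)
    (k : ℕ) (hk : k ≤ n - 2) (Y₂ : ℝ) (hY₂ : Y₂ < 0) :
    Tendsto (fun R : ℝ => ∫ x₂ in (-R)..R, ∫ x₁ : ℝ,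
        Complex.exp (Complex.I * ((x₂ : ℂ) + Complex.I * (Y₂ : ℂ))) *
          (x₁ : ℂ) ^ k * ((x₂ : ℂ) + Complex.I * (Y₂ : ℂ)) ^ (n - 2 - k) /
          ∏ j, ((x₁ : ℂ) + (m j : ℂ) * ((x₂ : ℂ) + Complex.I * (Y₂ : ℂ))))
      atTop (nhds (((2 : ℂ) * (Real.pi : ℂ) * Complex.I) ^ 2 *
        ∑ j ∈ Finset.univ.filter (fun j => 0 < m j),
          ((-m j : ℝ) : ℂ) ^ k / ∏ l ∈ Finset.univ.erase j, ((m l : ℂ) - (m j : ℂ)))) := by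

  set S : ℂ := ∑ j ∈ Finset.univ.filter (fun j => 0 < m j),
          ((-m j : ℝ) : ℂ) ^ k / ∏ l ∈ Finset.univ.erase j, ((m l : ℂ) - (m j : ℂ)) with hS
  have h := (jk_outer_s12 Y₂ hY₂).const_mul (2 * Real.pi * Complex.I * S)
  have e : 2 * Real.pi * Complex.I * S * (2 * Real.pi * Complex.I) =
      ((2 : ℂ) * (Real.pi : ℂ) * Complex.I) ^ 2 * S := by ring
  rw [e] at h
  refine h.congr fun R => ?_
  rw [← intervalIntegral.integral_const_mul]
  congr 1
  funext x
  have him : (Complex.I * Y₂ : ℂ).im ≠ 0 := by simpa using hY₂.ne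
  have hz := jk_ne _ him x
  have hzim : ((x : ℂ) + Complex.I * Y₂).im = Y₂ := by simp
  set z : ℂ := (x : ℂ) + Complex.I * Y₂ with hzdef
  have hai : ∀ j, ((m j : ℂ) * z).im = m j * Y₂ := by
    intro j
    rw [Complex.im_ofReal_mul, hzim]
  have hin := jk_inner_s12 n (fun j => (m j : ℂ) * z)
    (fun i j hij => hm (by exact_mod_cast mul_right_cancel₀ hz hij))
    (fun j => by rw [hai]; exact mul_ne_zero (hm0 j) hY₂.ne) k (by omega)
  have e2 : ∀ y : ℝ, Complex.exp (Complex.I * z) * (y : ℂ) ^ k * z ^ (n - 2 - k) /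
      ∏ j, ((y : ℂ) + (m j : ℂ) * z) = Complex.exp (Complex.I * z) * z ^ (n - 2 - k) *
      ((y : ℂ) ^ k / ∏ j, ((y : ℂ) + (m j : ℂ) * z)) := fun y => by ring
  simp_rw [e2]
  rw [MeasureTheory.integral_const_mul, hin]
  have hf : Finset.univ.filter (fun j => ((m j : ℂ) * z).im < 0) =
      Finset.univ.filter (fun j => 0 < m j) := by
    ext j
    simp only [Finset.mem_filter, Finset.mem_univ, true_and, hai]
    exact ⟨fun h => by nlinarith, fun h => mul_neg_of_pos_of_neg h hY₂⟩
  rw [hf]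
  have hs : ∑ j ∈ Finset.univ.filter (fun j => 0 < m j),
      (-((m j : ℂ) * z)) ^ k / ∏ l ∈ Finset.univ.erase j, ((m l : ℂ) * z - (m j : ℂ) * z) =
      S * (z ^ k / z ^ (n - 1)) := by
    rw [hS, Finset.sum_mul]
    refine Finset.sum_congr rfl fun j _ => ?_
    simp_rw [← sub_mul]
    rw [Finset.prod_mul_distrib, Finset.prod_const, Finset.card_erase_of_mem (Finset.mem_univ j),
      Finset.card_univ, Fintype.card_fin, ← neg_mul, mul_pow, Complex.ofReal_neg, div_mul_div_comm]
  rw [hs]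
  have hp : z ^ (n - 1) = z ^ (n - 2 - k) * z ^ k * z := by
    rw [← pow_add, ← pow_succ]
    congr 1
    omega
  rw [hp]
  field_simp
end
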